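/- Let K ≥ 1, t_0 > 0, and h_0, …, h_K ∈ ℝ with h_K ≠ 0. Define the unbounded operator H_0 in L^2(0,t_0) whose domain is the set of (equivalence classes of) restrictions to (0,t_0) of smooth functions on [0,t_0] vanishing in a neighborhood of 0, with (H_0 f)(t) = Σ_{k=0}^K (−1)^k h_k f^{(k)}(t_0−t). Then H_0 is densely defined, symmetric, and essentially self-adjoint: its closure equals its adjoint and is self-adjoint. -/

import Mathlib

open MeasureTheory Real Set

theorem abstract_esa {E : Type*} [NormedAddCommGroup E] [InnerProductSpace ℂ E] [CompleteSpace E]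
    (A : E →ₗ.[ℂ] E) (hd : Dense (A.domain : Set E))
    (hs : ∀ x y : A.domain, inner ℂ (A x) (y : E) = inner ℂ (x : E) (A y))
    (hr : Dense (Set.range fun x : A.domain => A x))
    (C : ℝ) (hC : 0 ≤ C) (hb : ∀ x : A.domain, ‖(x : E)‖ ≤ C * ‖A x‖) :
    A.closure = A.adjoint ∧ IsSelfAdjoint A.closure := by
  have hfa : A.IsFormalAdjoint A := hs
  have hle : A ≤ A.adjoint := hfa.le_adjoint hd
  have hcl : A.adjoint.IsClosed := LinearPMap.adjoint_isClosed hd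
  have hcb : A.IsClosable := hcl.isClosable.leIsClosable hle
  have hgle : A.closure.graph ≤ A.adjoint.graph := by
    rw [← hcb.graph_closure_eq_closure_graph]
    exact Submodule.topologicalClosure_minimal _ (LinearPMap.le_graph_of_le hle) hcl
  have hadj : ∀ p ∈ A.adjoint.graph, ∀ x : A.domain, inner ℂ p.2 (x : E) = inner ℂ p.1 (A x) := by
    intro p hp x
    obtain ⟨y, hy1, hy2⟩ := (LinearPMap.mem_graph_iff _).1 hp
    rw [← hy1, ← hy2]
    exact LinearPMap.adjoint_isFormalAdjoint hd y x
  have hge : A.adjoint.graph ≤ A.closure.graph := by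
    intro p hp
    have hw : p.2 ∈ closure (Set.range fun x : A.domain => A x) := hr _
    obtain ⟨u, hu, hlim⟩ := mem_closure_iff_seq_limit.1 hw
    choose x hx using hu
    have hcau : CauchySeq (fun n => (x n : E)) := by
      have h1 := hlim.cauchySeq
      rw [Metric.cauchySeq_iff] at h1 ⊢
      intro ε hε
      obtain ⟨N, hN⟩ := h1 (ε / (C + 1)) (by positivity)
      refine ⟨N, fun m hm n hn => ?_⟩
      have h2 := hN m hm n hn
      rw [dist_eq_norm] at h2 ⊢
      have h3 := hb (x m - x n)
      rw [LinearPMap.map_sub, ← hx m, ← hx n] at *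
      rw [lt_div_iff₀ (by positivity)] at h2
      simp only [AddSubgroupClass.coe_sub] at h3
      nlinarith [norm_nonneg (u m - u n)]
    obtain ⟨y, hy⟩ := cauchySeq_tendsto_of_complete hcau
    have hmem : (y, p.2) ∈ A.closure.graph := by
      rw [← hcb.graph_closure_eq_closure_graph]
      refine mem_closure_of_tendsto (hy.prodMk_nhds hlim) (Filter.Eventually.of_forall fun n => ?_)
      rw [← hx n]
      exact LinearPMap.mem_graph _ _
    have h1 := hadj _ (hgle hmem)
    have h2 := hadj p hp
    have h3 : y = p.1 := by
      refine hr.eq_of_inner_left ℂ ?_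
      rintro _ ⟨z, rfl⟩
      exact (h1 z).symm.trans (h2 z)
    rw [h3] at hmem
    exact hmem
  have heq : A.closure = A.adjoint := LinearPMap.eq_of_eq_graph (le_antisymm hgle hge)
  refine ⟨heq, ?_⟩
  rw [LinearPMap.isSelfAdjoint_def]
  have hd' : Dense (A.closure.domain : Set E) := hd.mono A.le_closure.1
  have hfa2 : A.closure.IsFormalAdjoint A.closure := by
    intro x y
    have hx := hgle (A.closure.mem_graph x)
    have hy := A.closure.mem_graph y
    rw [← hcb.graph_closure_eq_closure_graph] at hy
    have key : ∀ q ∈ closure (A.graph : Set (E × E)),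
        inner ℂ (A.closure x) q.1 = inner ℂ (x : E) q.2 := by
      intro q hq
      have hcs : IsClosed {q : E × E | inner ℂ (A.closure x) q.1 = inner ℂ (x : E) q.2} :=
        isClosed_eq (by fun_prop) (by fun_prop)
      refine closure_minimal ?_ hcs hq
      intro q hq
      obtain ⟨z, hz1, hz2⟩ := (LinearPMap.mem_graph_iff _).1 hq
      have := hadj _ hx z
      simp only [mem_ofPred_eq]
      rw [← hz1, ← hz2]
      exact this
    exact key _ hy
  apply le_antisymm
  · refine le_of_le_of_eq (b := A.adjoint) ?_ heq.symm
    refine LinearPMap.IsFormalAdjoint.le_adjoint hd ?_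
    have h3 := LinearPMap.adjoint_isFormalAdjoint hd'
    intro x y
    have h4 := (A.le_closure.2 (x := x) (y := ⟨x, A.le_closure.1 x.2⟩) rfl)
    rw [h4]
    exact h3.symm _ y
  · exact hfa2.le_adjoint hd'

/-- Smooth functions vanishing to the left of some positive point. -/
def WW : Submodule ℂ (ℝ → ℂ) where
  carrier := {f | ContDiff ℝ (⊤ : ℕ∞) f ∧ ∃ ε : ℝ, 0 < ε ∧ ∀ t : ℝ, t < ε → f t = 0}
  add_mem' := by
    rintro f g ⟨hf, e, he, hfe⟩ ⟨hg, d, hd, hgd⟩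
    refine ⟨hf.add hg, min e d, lt_min he hd, fun t ht => ?_⟩
    simp [hfe t (ht.trans_le (min_le_left _ _)), hgd t (ht.trans_le (min_le_right _ _))]
  zero_mem' := ⟨contDiff_const, 1, one_pos, fun _ _ => rfl⟩
  smul_mem' := by
    rintro c f ⟨hf, e, he, hfe⟩
    refine ⟨hf.const_smul c, e, he, fun t ht => ?_⟩
    simp [hfe t ht]

theorem WW_smooth (f : WW) : ContDiff ℝ (⊤ : ℕ∞) (f : ℝ → ℂ) := f.2.1

theorem WW_cont (f : WW) : Continuous (f : ℝ → ℂ) := f.2.1.continuous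

theorem WW_diff (f : WW) : Differentiable ℝ (f : ℝ → ℂ) := (contDiff_infty_iff_deriv.1 f.2.1).1

theorem WW_zero (f : WW) : (f : ℝ → ℂ) 0 = 0 := by
  obtain ⟨e, he, h⟩ := f.2.2
  exact h 0 he

/-- Differentiation. -/
noncomputable def DD : WW →ₗ[ℂ] WW where
  toFun f := ⟨deriv f, (contDiff_infty_iff_deriv.1 f.2.1).2, by
    obtain ⟨e, he, h⟩ := f.2.2
    refine ⟨e, he, fun t ht => ?_⟩
    have : (f : ℝ → ℂ) =ᶠ[nhds t] fun _ => 0 := by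
      filter_upwards [Iio_mem_nhds ht] with s hs using h s hs
    rw [this.deriv_eq]; simp⟩
  map_add' f g := by
    ext t
    exact deriv_add (WW_diff f t) (WW_diff g t)
  map_smul' c f := by
    ext t
    exact deriv_const_smul c (WW_diff f t)

theorem DD_coe (f : WW) : ((DD f : WW) : ℝ → ℂ) = deriv f := rfl

theorem DD_hasDeriv (f : WW) (t : ℝ) : HasDerivAt (f : ℝ → ℂ) (((DD f : WW) : ℝ → ℂ) t) t :=
  (WW_diff f t).hasDerivAt

theorem DD_pow (k : ℕ) (f : WW) : (((DD ^ k) f : WW) : ℝ → ℂ) = iteratedDeriv k f := by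
  induction k with
  | zero => simp
  | succ k ih => rw [pow_succ', iteratedDeriv_succ, ← ih]; rfl

/-- squared norm -/
noncomputable def NN (t₀ : ℝ) (f : ℝ → ℂ) : ℝ := ∫ t in (0 : ℝ)..t₀, ‖f t‖ ^ 2

theorem cs_aux (t₀ : ℝ) (ht₀ : 0 < t₀) (a : ℝ → ℝ) (ha : Continuous a) :
    (∫ t in (0 : ℝ)..t₀, a t) ^ 2 ≤ t₀ * ∫ t in (0 : ℝ)..t₀, a t ^ 2 := by
  set I := ∫ t in (0 : ℝ)..t₀, a t with hI
  have h0 : 0 ≤ ∫ t in (0 : ℝ)..t₀, (t₀ * a t - I) ^ 2 :=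
    intervalIntegral.integral_nonneg ht₀.le fun t _ => sq_nonneg _
  have h1 : (∫ t in (0 : ℝ)..t₀, (t₀ * a t - I) ^ 2)
      = t₀ ^ 2 * (∫ t in (0 : ℝ)..t₀, a t ^ 2) - 2 * t₀ * I * I + t₀ * I ^ 2 := by
    have : ∀ t, (t₀ * a t - I) ^ 2 = t₀ ^ 2 * a t ^ 2 - 2 * t₀ * I * a t + I ^ 2 := fun t => by ring
    simp_rw [this]
    rw [intervalIntegral.integral_add, intervalIntegral.integral_sub,
      intervalIntegral.integral_const_mul, intervalIntegral.integral_const_mul, ← hI]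
    · simp
    all_goals exact Continuous.intervalIntegrable (by fun_prop) _ _
  rw [h1] at h0
  have h2 : 0 ≤ t₀ * (t₀ * (∫ t in (0 : ℝ)..t₀, a t ^ 2) - I ^ 2) := by linarith
  have := nonneg_of_mul_nonneg_right h2 ht₀
  linarith

/-- invertible with bound -/
def QQ (t₀ : ℝ) (T : Module.End ℂ WW) : Prop :=
  Function.Surjective T ∧ ∃ C : ℝ, 0 ≤ C ∧ ∀ f : WW, NN t₀ f ≤ C * NN t₀ (T f)

theorem QQ_mul (t₀ : ℝ) (S T : Module.End ℂ WW) (hS : QQ t₀ S) (hT : QQ t₀ T) :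
    QQ t₀ (S * T) := by
  obtain ⟨hs, C, hC, hb⟩ := hS
  obtain ⟨ht, B, hB, hb'⟩ := hT
  refine ⟨hs.comp ht, B * C, by positivity, fun f => (hb' f).trans ?_⟩
  rw [mul_assoc]
  exact mul_le_mul_of_nonneg_left (hb _) hB

theorem QQ_lin_surj (l : ℂ) : Function.Surjective (DD - algebraMap ℂ (Module.End ℂ WW) l) := by
  intro g
  have hexp : ContDiff ℝ (⊤ : ℕ∞) (fun t : ℝ => Complex.exp (l * t)) :=
    (contDiff_const.mul Complex.ofRealCLM.contDiff).cexp
  have hexp' : ContDiff ℝ (⊤ : ℕ∞) (fun t : ℝ => Complex.exp (-l * t)) :=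
    (contDiff_const.mul Complex.ofRealCLM.contDiff).cexp
  have hphi : ContDiff ℝ (⊤ : ℕ∞) (fun t : ℝ => Complex.exp (-l * t) * (g : ℝ → ℂ) t) :=
    hexp'.mul (WW_smooth g)
  have hG : ∀ t : ℝ, HasDerivAt (fun t : ℝ => ∫ s in (0 : ℝ)..t, Complex.exp (-l * s) * (g : ℝ → ℂ) s)
      (Complex.exp (-l * t) * (g : ℝ → ℂ) t) t := fun t =>
    intervalIntegral.integral_hasDerivAt_right (hphi.continuous.intervalIntegrable _ _)
      (hphi.continuous.stronglyMeasurableAtFilter _ _) hphi.continuous.continuousAt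
  have hGs : ContDiff ℝ (⊤ : ℕ∞)
      (fun t : ℝ => ∫ s in (0 : ℝ)..t, Complex.exp (-l * s) * (g : ℝ → ℂ) s) := by
    rw [contDiff_infty_iff_deriv]
    refine ⟨fun t => (hG t).differentiableAt, ?_⟩
    rw [show deriv (fun t : ℝ => ∫ s in (0 : ℝ)..t, Complex.exp (-l * s) * (g : ℝ → ℂ) s) = _ from
      funext fun t => (hG t).deriv]
    exact hphi
  refine ⟨⟨fun t => Complex.exp (l * t) *
    ∫ s in (0 : ℝ)..t, Complex.exp (-l * s) * (g : ℝ → ℂ) s, hexp.mul hGs, ?_⟩, ?_⟩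
  · obtain ⟨e, he, hz⟩ := g.2.2
    refine ⟨e, he, fun t ht => ?_⟩
    have : ∫ s in (0 : ℝ)..t, Complex.exp (-l * s) * (g : ℝ → ℂ) s = ∫ s in (0 : ℝ)..t, (0 : ℂ) := by
      apply intervalIntegral.integral_congr
      intro s hs
      have : s < e := by
        rw [mem_uIcc] at hs
        rcases hs with hs | hs <;> linarith [hs.1, hs.2]
      simp [hz s this]
    simp only [this, intervalIntegral.integral_zero, mul_zero]
  · ext t
    have h1 : HasDerivAt (fun t : ℝ => Complex.exp (l * t)) (l * Complex.exp (l * t)) t := by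
      have := ((hasDerivAt_id t).ofReal_comp.const_mul l).cexp
      simpa [mul_comm] using this
    have h2 := (h1.mul (hG t)).deriv
    simp only [LinearMap.sub_apply, Module.algebraMap_end_apply, Submodule.coe_sub, Pi.sub_apply,
      Submodule.coe_smul, Pi.smul_apply, DD_coe, smul_eq_mul]
    refine (congrArg (· - _) h2).trans ?_
    have h3 : Complex.exp (l * t) * Complex.exp (-l * t) = 1 := by
      rw [← Complex.exp_add]; simp
    linear_combination (g : ℝ → ℂ) t * h3

theorem QQ_lin (t₀ : ℝ) (ht₀ : 0 < t₀) (l : ℂ) :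
    QQ t₀ (DD - algebraMap ℂ (Module.End ℂ WW) l) := by
  refine ⟨QQ_lin_surj l, ?_⟩
  set M := Real.exp (‖l‖ * t₀) with hM
  have hMp : 0 < M := Real.exp_pos _
  have hMb : ∀ (z : ℂ) (t : ℝ), ‖z‖ = ‖l‖ → t ∈ Icc 0 t₀ → ‖Complex.exp (z * t)‖ ≤ M := by
    intro z t hz ht
    refine (Complex.norm_exp_le_exp_norm _).trans ?_
    rw [hM, Real.exp_le_exp, norm_mul, hz, Complex.norm_real, Real.norm_of_nonneg ht.1]
    exact mul_le_mul_of_nonneg_left ht.2 (norm_nonneg _)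
  refine ⟨t₀ * (M ^ 4 * t₀), by positivity, fun f => ?_⟩
  set g : WW := (DD - algebraMap ℂ (Module.End ℂ WW) l) f with hg
  have hgc := WW_cont g
  have hgt : ∀ t, ((DD f : WW) : ℝ → ℂ) t = (g : ℝ → ℂ) t + l * (f : ℝ → ℂ) t := by
    intro t
    simp [hg]
  have hder : ∀ t : ℝ, HasDerivAt (fun t : ℝ => Complex.exp (-l * t) * (f : ℝ → ℂ) t)
      (Complex.exp (-l * t) * (g : ℝ → ℂ) t) t := by
    intro t
    have h1 : HasDerivAt (fun t : ℝ => Complex.exp (-l * t)) (-l * Complex.exp (-l * t)) t := by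
      have := ((hasDerivAt_id t).ofReal_comp.const_mul (-l)).cexp
      simpa [mul_comm] using this
    have h2 := h1.mul (DD_hasDeriv f t)
    rw [hgt] at h2
    refine h2.congr_deriv ?_
    ring
  have hpt : ∀ t ∈ Icc 0 t₀, ‖(f : ℝ → ℂ) t‖ ≤ M ^ 2 * ∫ s in (0 : ℝ)..t₀, ‖(g : ℝ → ℂ) s‖ := by
    intro t ht
    have h1 : ∫ s in (0 : ℝ)..t, Complex.exp (-l * s) * (g : ℝ → ℂ) s
        = Complex.exp (-l * t) * (f : ℝ → ℂ) t := by
      rw [intervalIntegral.integral_eq_sub_of_hasDerivAt (fun s _ => hder s)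
        (Continuous.intervalIntegrable (by fun_prop) _ _), WW_zero]
      simp
    have h2 : ‖Complex.exp (-l * t) * (f : ℝ → ℂ) t‖ ≤ M * ∫ s in (0 : ℝ)..t₀, ‖(g : ℝ → ℂ) s‖ := by
      rw [← h1, ← intervalIntegral.integral_const_mul]
      refine (intervalIntegral.norm_integral_le_integral_norm ht.1).trans ?_
      refine (intervalIntegral.integral_mono_on (g := fun s => M * ‖(g : ℝ → ℂ) s‖) ht.1
        (Continuous.intervalIntegrable (by fun_prop) _ _)
        (Continuous.intervalIntegrable (by fun_prop) _ _) ?_).trans ?_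
      · intro s hs
        rw [norm_mul]
        exact mul_le_mul_of_nonneg_right
          (hMb _ _ (norm_neg _) ⟨hs.1, hs.2.trans ht.2⟩) (norm_nonneg _)
      · refine intervalIntegral.integral_mono_interval le_rfl ht.1 ht.2 ?_
          (Continuous.intervalIntegrable (by fun_prop) _ _)
        exact Filter.Eventually.of_forall fun s => by simp only [Pi.zero_apply]; positivity
    have h3 : (f : ℝ → ℂ) t = Complex.exp (l * t) * (Complex.exp (-l * t) * (f : ℝ → ℂ) t) := by
      rw [← mul_assoc, ← Complex.exp_add]; simp
    rw [h3, norm_mul, pow_two, mul_assoc]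
    exact mul_le_mul (hMb _ _ rfl ht) h2 (norm_nonneg _) hMp.le
  have hcs := cs_aux t₀ ht₀ (fun s => ‖(g : ℝ → ℂ) s‖) (by fun_prop)
  have hfc := WW_cont f
  unfold NN
  calc ∫ t in (0 : ℝ)..t₀, ‖(f : ℝ → ℂ) t‖ ^ 2
      ≤ ∫ t in (0 : ℝ)..t₀, M ^ 4 * (t₀ * ∫ t in (0 : ℝ)..t₀, ‖(g : ℝ → ℂ) t‖ ^ 2) := by
        refine intervalIntegral.integral_mono_on ht₀.le
          (Continuous.intervalIntegrable (by fun_prop) _ _)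
          (Continuous.intervalIntegrable (by fun_prop) _ _) fun t ht => ?_
        calc ‖(f : ℝ → ℂ) t‖ ^ 2 ≤ (M ^ 2 * ∫ s in (0 : ℝ)..t₀, ‖(g : ℝ → ℂ) s‖) ^ 2 :=
              pow_le_pow_left₀ (norm_nonneg _) (hpt t ht) 2
          _ = M ^ 4 * (∫ s in (0 : ℝ)..t₀, ‖(g : ℝ → ℂ) s‖) ^ 2 := by ring
          _ ≤ _ := mul_le_mul_of_nonneg_left hcs (by positivity)
    _ = _ := by simp; ring

theorem QQ_const (t₀ : ℝ) (c : ℂ) (hc : c ≠ 0) :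
    QQ t₀ (algebraMap ℂ (Module.End ℂ WW) c) := by
  refine ⟨fun g => ⟨c⁻¹ • g, by simp [smul_smul, hc]⟩, (‖c‖ ^ 2)⁻¹, by positivity, fun f => ?_⟩
  have hc' : ‖c‖ ≠ 0 := by simpa using hc
  simp [NN, mul_pow, hc']

theorem QQ_poly (t₀ : ℝ) (ht₀ : 0 < t₀) (p : Polynomial ℂ) (hp : p ≠ 0) :
    QQ t₀ (Polynomial.aeval DD p) := by
  induction hn : p.natDegree generalizing p with
  | zero =>
    rw [Polynomial.eq_C_of_natDegree_eq_zero hn] at hp ⊢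
    rw [Polynomial.aeval_C]
    exact QQ_const t₀ _ (by simpa using hp)
  | succ n ih =>
    obtain ⟨z, hz⟩ := IsAlgClosed.exists_root p (by
      intro h0
      have h1 : p.natDegree = 0 := Polynomial.natDegree_eq_zero_iff_degree_le_zero.2 h0.le
      omega)
    obtain ⟨q, hq⟩ := Polynomial.dvd_iff_isRoot.2 hz
    have hq0 : q ≠ 0 := by rintro rfl; simp at hq; exact hp hq
    have hdeg : q.natDegree = n := by
      rw [hq, Polynomial.natDegree_mul (Polynomial.X_sub_C_ne_zero z) hq0,
        Polynomial.natDegree_X_sub_C] at hn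
      omega
    rw [hq, map_mul]
    refine QQ_mul _ _ _ ?_ (ih q hq0 hdeg)
    simpa using QQ_lin t₀ ht₀ z

/-- the Hilbert space -/
noncomputable abbrev L2 (t₀ : ℝ) := Lp ℂ 2 (volume.restrict (Ioo (0 : ℝ) t₀))

theorem L2_inner (t₀ : ℝ) (ht₀ : 0 < t₀) (F G : L2 t₀) (f g : ℝ → ℂ)
    (hf : ⇑F =ᵐ[volume.restrict (Ioo (0 : ℝ) t₀)] f)
    (hg : ⇑G =ᵐ[volume.restrict (Ioo (0 : ℝ) t₀)] g) :
    inner ℂ F G = ∫ t in (0 : ℝ)..t₀, star (f t) * g t := by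
  rw [L2.inner_def, intervalIntegral.integral_of_le ht₀.le, integral_Ioc_eq_integral_Ioo]
  apply integral_congr_ae
  filter_upwards [hf, hg] with t h1 h2
  rw [h1, h2, RCLike.inner_apply, mul_comm]
  rfl

theorem L2_norm (t₀ : ℝ) (ht₀ : 0 < t₀) (F : L2 t₀) (f : ℝ → ℂ)
    (hf : ⇑F =ᵐ[volume.restrict (Ioo (0 : ℝ) t₀)] f) : ‖F‖ ^ 2 = NN t₀ f := by
  have h1 := L2_inner t₀ ht₀ F F f f hf hf
  rw [inner_self_eq_norm_sq_to_K] at h1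
  have h2 : (∫ t in (0 : ℝ)..t₀, star (f t) * f t) = ((NN t₀ f : ℝ) : ℂ) := by
    rw [NN, ← intervalIntegral.integral_ofReal]
    congr 1
    ext t
    have := Complex.conj_mul' (f t)
    rw [Complex.ofReal_pow]
    exact this
  rw [h2] at h1
  have h3 : ((‖F‖ ^ 2 : ℝ) : ℂ) = ((NN t₀ f : ℝ) : ℂ) := by
    rw [← h1]
    exact Complex.ofReal_pow _ _
  exact Complex.ofReal_injective h3

theorem NN_refl (t₀ : ℝ) (f : ℝ → ℂ) : NN t₀ (fun t => f (t₀ - t)) = NN t₀ f := by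
  unfold NN
  rw [intervalIntegral.integral_comp_sub_left (fun t => ‖f t‖ ^ 2)]
  simp

theorem WW_memLp (t₀ : ℝ) (f : WW) :
    MemLp (f : ℝ → ℂ) 2 (volume.restrict (Ioo (0 : ℝ) t₀)) := by
  have h := WW_cont f
  obtain ⟨C, hC⟩ := (isCompact_Icc (a := (0 : ℝ)) (b := t₀)).exists_bound_of_continuousOn
    h.continuousOn
  refine MemLp.of_bound h.aestronglyMeasurable C ?_
  filter_upwards [ae_restrict_mem measurableSet_Ioo] with t ht
  exact hC t ⟨ht.1.le, ht.2.le⟩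

theorem dense_aux (t₀ : ℝ) (S : Submodule ℂ (L2 t₀))
    (hS : ∀ g : ℝ → ℝ, ContDiff ℝ (⊤ : ℕ∞) g → HasCompactSupport g →
      tsupport g ⊆ Ioo (0 : ℝ) t₀ →
      ∃ F ∈ S, ⇑F =ᵐ[volume.restrict (Ioo (0 : ℝ) t₀)] fun t => (g t : ℂ)) :
    Dense (S : Set (L2 t₀)) := by
  rw [Submodule.dense_iff_topologicalClosure_eq_top, Submodule.topologicalClosure_eq_top_iff,
    Submodule.eq_bot_iff]
  intro y hy
  have hint : IntegrableOn (⇑y) (Ioo (0 : ℝ) t₀) volume :=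
    (Lp.memLp y).integrable (by norm_num)
  have h0 := isOpen_Ioo.ae_eq_zero_of_integral_contDiff_smul_eq_zero (μ := volume)
    hint.locallyIntegrableOn (by
      intro g hg hgc hgs
      obtain ⟨F, hF, hFg⟩ := hS g hg hgc hgs
      have h1 := (Submodule.mem_orthogonal _ _).1 hy F hF
      rw [L2.inner_def] at h1
      rw [← h1, ← setIntegral_eq_integral_of_forall_compl_eq_zero (s := Ioo (0 : ℝ) t₀)]
      · apply integral_congr_ae
        filter_upwards [hFg] with t ht
        rw [ht, RCLike.inner_apply]
        simp [mul_comm]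
      · intro t ht
        have : g t = 0 := by
          by_contra hne
          exact ht (hgs (subset_tsupport g hne))
        simp [this])
  rw [Lp.eq_zero_iff_ae_eq_zero, Filter.EventuallyEq, ae_restrict_iff' measurableSet_Ioo]
  exact h0

theorem bump_mem (t₀ : ℝ) (ht₀ : 0 < t₀) (g : ℝ → ℝ) (hg : ContDiff ℝ (⊤ : ℕ∞) g)
    (hgs : tsupport g ⊆ Ioo (0 : ℝ) t₀) :
    (fun t => (g t : ℂ)) ∈ WW ∧ (fun t => (g (t₀ - t) : ℂ)) ∈ WW := by
  have hz : ∀ t, t ∉ Ioo (0 : ℝ) t₀ → g t = 0 := by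
    intro t ht
    by_contra hne
    exact ht (hgs (subset_tsupport g hne))
  have hloc : ∀ a, a ∉ Ioo (0 : ℝ) t₀ → ∃ e > 0, ∀ t, |t - a| < e → g t = 0 := by
    intro a ha
    have h1 : (tsupport g)ᶜ ∈ nhds a :=
      (isClosed_tsupport g).isOpen_compl.mem_nhds fun h => ha (hgs h)
    obtain ⟨e, he, hb⟩ := Metric.mem_nhds_iff.1 h1
    refine ⟨e, he, fun t ht => ?_⟩
    exact image_eq_zero_of_notMem_tsupport (hb (by simpa [Real.dist_eq] using ht))
  constructor
  · refine ⟨Complex.ofRealCLM.contDiff.comp hg, ?_⟩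
    obtain ⟨e, he, hb⟩ := hloc 0 (by simp)
    refine ⟨e, he, fun t ht => ?_⟩
    rcases le_or_gt t 0 with h | h
    · simp [hz t fun h' => absurd h'.1 (not_lt.2 h)]
    · simp [hb t (by rw [sub_zero, abs_of_pos h]; exact ht)]
  · refine ⟨Complex.ofRealCLM.contDiff.comp (hg.comp (contDiff_const.sub contDiff_id)), ?_⟩
    obtain ⟨e, he, hb⟩ := hloc t₀ (by simp)
    refine ⟨e, he, fun t ht => ?_⟩
    rcases le_or_gt t 0 with h | h
    · simp [hz (t₀ - t) fun h' => by linarith [h'.2]]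
    · simp [hb (t₀ - t) (by rw [sub_sub_cancel_left, abs_neg, abs_of_pos h]; exact ht)]

/-- sesquilinear form -/
noncomputable def SS (t₀ : ℝ) (u v : WW) : ℂ :=
  ∫ t in (0 : ℝ)..t₀, star ((u : ℝ → ℂ) (t₀ - t)) * (v : ℝ → ℂ) t

theorem SS_D (t₀ : ℝ) (u v : WW) : SS t₀ (DD u) v = SS t₀ u (DD v) := by
  have hu := WW_cont u
  have hv := WW_cont v
  have hu' := WW_cont (DD u)
  have hv' := WW_cont (DD v)
  have hder : ∀ t : ℝ, HasDerivAt (fun t => star ((u : ℝ → ℂ) (t₀ - t)) * (v : ℝ → ℂ) t)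
      (star ((u : ℝ → ℂ) (t₀ - t)) * ((DD v : WW) : ℝ → ℂ) t
        - star (((DD u : WW) : ℝ → ℂ) (t₀ - t)) * (v : ℝ → ℂ) t) t := by
    intro t
    have h1 : HasDerivAt (fun t => (u : ℝ → ℂ) (t₀ - t))
        (-(((DD u : WW) : ℝ → ℂ) (t₀ - t))) t := (DD_hasDeriv u (t₀ - t)).comp_const_sub t₀ t
    refine (h1.star.mul (DD_hasDeriv v t)).congr_deriv ?_
    rw [star_neg]
    ring
  have h := intervalIntegral.integral_eq_sub_of_hasDerivAt (a := 0) (b := t₀) (fun s _ => hder s)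
        (Continuous.intervalIntegrable (by fun_prop) _ _)
  rw [intervalIntegral.integral_sub (Continuous.intervalIntegrable (by fun_prop) _ _)
    (Continuous.intervalIntegrable (by fun_prop) _ _), sub_self, WW_zero, WW_zero] at h
  simp only [star_zero, mul_zero, zero_mul, sub_zero] at h
  exact (sub_eq_zero.1 h).symm

theorem SS_Dk (t₀ : ℝ) (k : ℕ) (u v : WW) : SS t₀ ((DD ^ k) u) v = SS t₀ u ((DD ^ k) v) := by
  induction k generalizing u v with
  | zero => simp
  | succ k ih =>
    rw [pow_succ, Module.End.mul_apply, ih, SS_D, ← Module.End.mul_apply, ← pow_succ', pow_succ]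

/-- symbol -/
noncomputable def PP (K : ℕ) (h : ℕ → ℝ) : Polynomial ℂ :=
  ∑ k ∈ Finset.range (K + 1), Polynomial.C ((-1 : ℂ) ^ k * (h k : ℂ)) * Polynomial.X ^ k

theorem PP_ne (K : ℕ) (h : ℕ → ℝ) (hK : h K ≠ 0) : PP K h ≠ 0 := by
  intro h0
  have h1 := congrArg (fun p => Polynomial.coeff p K) h0
  simp only [PP, Polynomial.finsetSum_coeff, Polynomial.coeff_C_mul, Polynomial.coeff_X_pow,
    Polynomial.coeff_zero] at h1
  simp at h1
  exact hK h1

theorem PP_aeval (K : ℕ) (h : ℕ → ℝ) (f : WW) :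
    Polynomial.aeval DD (PP K h) f
      = ∑ k ∈ Finset.range (K + 1), ((-1 : ℂ) ^ k * (h k : ℂ)) • (DD ^ k) f := by
  rw [PP, map_sum, LinearMap.sum_apply]
  refine Finset.sum_congr rfl fun k _ => ?_
  rw [map_mul, Polynomial.aeval_C, map_pow, Polynomial.aeval_X, Module.End.mul_apply,
    Module.algebraMap_end_apply]

theorem PP_apply (K : ℕ) (h : ℕ → ℝ) (f : WW) (t : ℝ) :
    (Polynomial.aeval DD (PP K h) f : ℝ → ℂ) t
      = ∑ k ∈ Finset.range (K + 1), (-1 : ℂ) ^ k * (h k : ℂ) * iteratedDeriv k f t := by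
  rw [PP_aeval]
  simp [DD_pow]

theorem SS_P (t₀ : ℝ) (K : ℕ) (h : ℕ → ℝ) (u v : WW) :
    SS t₀ (Polynomial.aeval DD (PP K h) u) v = SS t₀ u (Polynomial.aeval DD (PP K h) v) := by
  rw [PP_aeval, PP_aeval]
  have hv := WW_cont v
  have hu := WW_cont u
  have e1 : SS t₀ (∑ k ∈ Finset.range (K + 1), ((-1 : ℂ) ^ k * (h k : ℂ)) • (DD ^ k) u) v
      = ∑ k ∈ Finset.range (K + 1), ((-1 : ℂ) ^ k * (h k : ℂ)) * SS t₀ ((DD ^ k) u) v := by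
    unfold SS
    simp_rw [← intervalIntegral.integral_const_mul]
    rw [← intervalIntegral.integral_finsetSum]
    · congr 1
      ext t
      simp [Finset.sum_mul, mul_assoc]
    · intro k _
      have := WW_cont ((DD ^ k) u)
      exact Continuous.intervalIntegrable (by fun_prop) _ _
  have e2 : SS t₀ u (∑ k ∈ Finset.range (K + 1), ((-1 : ℂ) ^ k * (h k : ℂ)) • (DD ^ k) v)
      = ∑ k ∈ Finset.range (K + 1), ((-1 : ℂ) ^ k * (h k : ℂ)) * SS t₀ u ((DD ^ k) v) := by
    unfold SS
    simp_rw [← intervalIntegral.integral_const_mul]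
    rw [← intervalIntegral.integral_finsetSum]
    · congr 1
      ext t
      simp [Finset.mul_sum, mul_left_comm]
    · intro k _
      have := WW_cont ((DD ^ k) v)
      exact Continuous.intervalIntegrable (by fun_prop) _ _
  rw [e1, e2]
  simp_rw [SS_Dk]

/-- Let `K ≥ 1`, `t₀ > 0` and `h₀,…,h_K ∈ ℝ` with `h_K ≠ 0`.  The operator
`(H₀ f)(t) = ∑_{k=0}^K (−1)^k h_k f^{(k)}(t₀−t)` in `L²(0,t₀)`, with domain the (classes of)
restrictions of smooth functions vanishing in a neighborhood of `0`, is densely defined,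
symmetric, and essentially self-adjoint: its closure equals its adjoint and is
self-adjoint. -/
theorem delta_kernel_hankel_essentially_selfAdjoint
    (K : ℕ) (hK : 1 ≤ K) (t₀ : ℝ) (ht₀ : 0 < t₀) (h : ℕ → ℝ) (hhK : h K ≠ 0)
    (H₀ : Lp ℂ 2 (volume.restrict (Ioo (0 : ℝ) t₀))
      →ₗ.[ℂ] Lp ℂ 2 (volume.restrict (Ioo (0 : ℝ) t₀)))
    (hdom : ∀ F : Lp ℂ 2 (volume.restrict (Ioo (0 : ℝ) t₀)), F ∈ H₀.domain ↔
      ∃ f : ℝ → ℂ, ContDiff ℝ (⊤ : ℕ∞) f ∧ (∃ ε : ℝ, 0 < ε ∧ ∀ t : ℝ, t < ε → f t = 0) ∧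
        ⇑F =ᵐ[volume.restrict (Ioo (0 : ℝ) t₀)] f)
    (hact : ∀ (F : H₀.domain) (f : ℝ → ℂ), ContDiff ℝ (⊤ : ℕ∞) f →
      (∃ ε : ℝ, 0 < ε ∧ ∀ t : ℝ, t < ε → f t = 0) →
      ⇑(F : Lp ℂ 2 (volume.restrict (Ioo (0 : ℝ) t₀)))
          =ᵐ[volume.restrict (Ioo (0 : ℝ) t₀)] f →
      ⇑(H₀ F) =ᵐ[volume.restrict (Ioo (0 : ℝ) t₀)]
        fun t => ∑ k ∈ Finset.range (K + 1),
          (-1 : ℂ) ^ k * (h k : ℂ) * iteratedDeriv k f (t₀ - t)) :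
    Dense (H₀.domain : Set (Lp ℂ 2 (volume.restrict (Ioo (0 : ℝ) t₀))))
      ∧ (∀ x y : H₀.domain,
          inner (𝕜 := ℂ) (H₀ x) ((y : Lp ℂ 2 (volume.restrict (Ioo (0 : ℝ) t₀))))
            = inner (𝕜 := ℂ) ((x : Lp ℂ 2 (volume.restrict (Ioo (0 : ℝ) t₀)))) (H₀ y))
      ∧ H₀.closure = H₀.adjoint
      ∧ IsSelfAdjoint H₀.closure := by
  have hrep : ∀ F : H₀.domain, ∃ f : WW,
      ⇑(F : L2 t₀) =ᵐ[volume.restrict (Ioo (0 : ℝ) t₀)] (f : ℝ → ℂ) ∧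
      ⇑(H₀ F) =ᵐ[volume.restrict (Ioo (0 : ℝ) t₀)]
        fun t => (Polynomial.aeval DD (PP K h) f : ℝ → ℂ) (t₀ - t) := by
    intro F
    obtain ⟨f, hf, hfe, hFf⟩ := (hdom F).1 F.2
    refine ⟨⟨f, hf, hfe⟩, hFf, ?_⟩
    simp_rw [PP_apply]
    exact hact F f hf hfe hFf
  have hex : ∀ f : WW, ∃ F : H₀.domain,
      ⇑(F : L2 t₀) =ᵐ[volume.restrict (Ioo (0 : ℝ) t₀)] (f : ℝ → ℂ) ∧
      ⇑(H₀ F) =ᵐ[volume.restrict (Ioo (0 : ℝ) t₀)]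
        fun t => (Polynomial.aeval DD (PP K h) f : ℝ → ℂ) (t₀ - t) := by
    intro f
    have h1 := (WW_memLp t₀ f).coeFn_toLp
    refine ⟨⟨(WW_memLp t₀ f).toLp _, (hdom _).2 ⟨f, f.2.1, f.2.2, h1⟩⟩, h1, ?_⟩
    simp_rw [PP_apply]
    exact hact _ f f.2.1 f.2.2 h1
  obtain ⟨hsurj, C, hC, hbd⟩ := QQ_poly t₀ ht₀ (PP K h) (PP_ne K h hhK)
  have hd : Dense (H₀.domain : Set (L2 t₀)) := by
    refine dense_aux t₀ _ fun g hg _ hgs => ?_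
    obtain ⟨F, hF, -⟩ := hex ⟨_, (bump_mem t₀ ht₀ g hg hgs).1⟩
    exact ⟨F, F.2, hF⟩
  have hsym : ∀ x y : H₀.domain,
      inner (𝕜 := ℂ) (H₀ x) (y : L2 t₀) = inner (𝕜 := ℂ) (x : L2 t₀) (H₀ y) := by
    intro x y
    obtain ⟨u, hu, hu'⟩ := hrep x
    obtain ⟨v, hv, hv'⟩ := hrep y
    rw [L2_inner t₀ ht₀ _ _ _ _ hu' hv, L2_inner t₀ ht₀ _ _ _ _ hu hv']
    refine (SS_P t₀ K h u v).trans ?_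
    have := intervalIntegral.integral_comp_sub_left (a := 0) (b := t₀)
      (fun t => star ((u : ℝ → ℂ) t) *
        (Polynomial.aeval DD (PP K h) v : ℝ → ℂ) (t₀ - t)) t₀
    simp only [sub_sub_cancel, sub_self, sub_zero] at this
    exact this
  have hr : Dense (Set.range fun x : H₀.domain => H₀ x) := by
    have h1 : Dense ((LinearMap.range H₀.toFun : Submodule ℂ (L2 t₀)) : Set (L2 t₀)) := by
      refine dense_aux t₀ _ fun g hg _ hgs => ?_
      obtain ⟨f, hf⟩ := hsurj ⟨_, (bump_mem t₀ ht₀ g hg hgs).2⟩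
      obtain ⟨F, -, hF⟩ := hex f
      refine ⟨H₀ F, ⟨F, rfl⟩, ?_⟩
      rw [hf] at hF
      simpa using hF
    exact h1
  refine ⟨hd, hsym, abstract_esa H₀ hd hsym hr (Real.sqrt C) (Real.sqrt_nonneg _) fun x => ?_⟩
  obtain ⟨f, hf, hf'⟩ := hrep x
  have h1 := L2_norm t₀ ht₀ _ _ hf
  have h2 := L2_norm t₀ ht₀ _ _ hf'
  rw [NN_refl] at h2
  have h3 := hbd f
  rw [← h1, ← h2] at h3
  rw [← Real.sqrt_sq (norm_nonneg (H₀ x)), ← Real.sqrt_mul hC]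
  exact Real.le_sqrt_of_sq_le h3
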